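/- arXiv:1408.0053 — 3 statements merged into one kernel-verified Lean document; each statement's English description precedes it below -/
import Mathlib

section
/- Let N = (B,E,F) be a locally finite, K-dense causal net with X = B ∪ E. Let A ⊆ X be a closed set (A = A'') and let λ be a line of N. Then λ ∩ A ≠ ∅ if and only if λ ∩ A' = ∅. -/
/-- A causal net `N = (B, E, F)`: conditions `B` and events `E` are disjoint
countable sets covering the carrier, `F ⊆ (B × E) ∪ (E × B)` is the flow
relation, every element is in `dom F ∪ ran F`, every condition has at most one
`F`-predecessor and at most one `F`-successor, and `F⁺` is irreflexive. -/
structure CausalNet (α : Type*) where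
  B : Set α
  E : Set α
  F : α → α → Prop
  countable_B : B.Countable
  countable_E : E.Countable
  disjoint_BE : Disjoint B E
  cover : B ∪ E = Set.univ
  bipartite : ∀ x y, F x y → (x ∈ B ∧ y ∈ E) ∨ (x ∈ E ∧ y ∈ B)
  no_isolated : ∀ x, (∃ y, F x y) ∨ (∃ y, F y x)
  pred_subsingleton : ∀ b ∈ B, {e | F e b}.Subsingleton
  succ_subsingleton : ∀ b ∈ B, {e | F b e}.Subsingleton
  acyclic : ∀ x, ¬ Relation.TransGen F x x

namespace CausalNet

variable {α : Type*} (N : CausalNet α)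

/-- The causal order `⊑ = F*` (reflexive-transitive closure of `F`). -/
def le (x y : α) : Prop := Relation.ReflTransGen N.F x y

/-- `li = ⊑ ∪ ⊒`: causal relatedness. -/
def li (x y : α) : Prop := N.le x y ∨ N.le y x

/-- `co = (X × X) \ li`: concurrency (causal independence). -/
def co (x y : α) : Prop := ¬ N.li x y

/-- `A' = {x | ∀ y ∈ A, x co y}`, the orthocomplement of `A`. -/
def prime (A : Set α) : Set α := {x | ∀ y ∈ A, N.co x y}

/-- `A` is closed iff `A = A''`. -/
def Closed (A : Set α) : Prop := A = N.prime (N.prime A)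

/-- A line is a maximal clique of `li`. -/
def IsLine (l : Set α) : Prop :=
  l.Pairwise N.li ∧ ∀ m : Set α, m.Pairwise N.li → l ⊆ m → m = l

/-- A cut is a maximal clique of `co ∪ id`, i.e. a maximal antichain. -/
def IsCut (c : Set α) : Prop :=
  c.Pairwise N.co ∧ ∀ m : Set α, m.Pairwise N.co → c ⊆ m → m = c

/-- K-density: every cut meets every line. -/
def KDense : Prop :=
  ∀ c l : Set α, N.IsCut c → N.IsLine l → (c ∩ l).Nonempty

/-- The interval `[x, y] = {z | x ⊑ z ⊑ y}`. -/
def interval (x y : α) : Set α := {z | N.le x z ∧ N.le z y}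

/-- Local finiteness: intervals are finite and every element has finitely many
immediate `F`-predecessors and immediate `F`-successors. -/
def LocallyFinite : Prop :=
  (∀ x y, (N.interval x y).Finite) ∧
  (∀ x, {y | N.F y x}.Finite) ∧ (∀ x, {y | N.F x y}.Finite)

/-- A B-cut of a subset `S`: a maximal antichain of `(S, ⊑)` consisting only of
conditions. -/
def IsBCutOf (S τ : Set α) : Prop :=
  τ ⊆ S ∧ τ ⊆ N.B ∧ τ.Pairwise N.co ∧
  ∀ m : Set α, m ⊆ S → m.Pairwise N.co → τ ⊆ m → m = τ

/-- Preconditions `•e` of an event. -/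
def pre (e : α) : Set α := {b | N.F b e}

/-- Postconditions `e•` of an event. -/
def post (e : α) : Set α := {b | N.F e b}

/-- Causally closed sets (Definition of `CC(N)`). -/
def CausallyClosed (C : Set α) : Prop :=
  (∀ e ∈ N.E, N.pre e ⊆ C → e ∈ C) ∧
  (∀ e ∈ N.E, N.post e ⊆ C → e ∈ C) ∧
  (∀ e ∈ N.E, e ∈ C → N.pre e ∪ N.post e ⊆ C) ∧
  (∀ x ∈ C, ∀ y ∈ C, N.li x y → N.interval x y ⊆ C)

end CausalNet

namespace CausalNet

variable {α : Type*} {N : CausalNet α}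

lemma le_trans {x y z : α} (hxy : N.le x y) (hyz : N.le y z) : N.le x z :=
  Relation.ReflTransGen.trans hxy hyz

lemma le_refl (x : α) : N.le x x := Relation.ReflTransGen.refl

lemma le_of_F {x y : α} (h : N.F x y) : N.le x y := Relation.ReflTransGen.single h

lemma not_le_of_F {x y : α} (h : N.F x y) : ¬ N.le y x := fun hyx =>
  N.acyclic x (Relation.TransGen.head' h hyx)

lemma li_symm {x y : α} (h : N.li x y) : N.li y x := Or.symm h

/-- The unique successor of a condition lies below everything strictly above the condition. -/
lemma le_of_mem_B_of_F {x y z : α} (hx : x ∈ N.B) (hxy : N.F x y) (hxz : N.le x z)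
    (hne : x ≠ z) : N.le y z := by
  rcases Relation.ReflTransGen.cases_head hxz with h | ⟨c, hc, hcz⟩
  · exact (hne h).elim
  · rwa [N.succ_subsingleton x hx hxy hc]

/-- The unique predecessor of a condition lies above everything strictly below the condition. -/
lemma le_of_F_of_mem_B {x y z : α} (hy : y ∈ N.B) (hxy : N.F x y) (hzy : N.le z y)
    (hne : z ≠ y) : N.le z x := by
  rcases Relation.ReflTransGen.cases_tail hzy with h | ⟨c, hzc, hc⟩
  · exact (hne h.symm).elim
  · rwa [N.pred_subsingleton y hy hxy hc]

lemma IsLine.li_of_mem {l : Set α} (hl : N.IsLine l) {x y : α} (hx : x ∈ l) (hy : y ∈ l) :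
    N.li x y := by
  by_cases h : x = y
  · exact Or.inl (h ▸ le_refl x)
  · exact hl.1 hx hy h

lemma IsLine.mem_of_forall_li {l : Set α} (hl : N.IsLine l) {x : α}
    (hx : ∀ y ∈ l, N.li x y) : x ∈ l := by
  rw [← hl.2 (insert x l) (hl.1.insert fun y hy _ => ⟨hx y hy, li_symm (hx y hy)⟩)
    (Set.subset_insert x l)]
  exact Set.mem_insert x l

/-- Every antichain extends to a cut. -/
lemma exists_isCut_superset {S : Set α} (hS : S.Pairwise N.co) : ∃ C, S ⊆ C ∧ N.IsCut C := by
  obtain ⟨C, hSC, hC⟩ := zorn_subset_nonempty {T : Set α | T.Pairwise N.co}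
    (fun c hc hchain _ => ⟨⋃₀ c, (Set.pairwise_sUnion hchain.directedOn).2 fun a ha => hc ha,
      fun s hs => Set.subset_sUnion_of_mem hs⟩) S hS
  exact ⟨C, hSC, hC.prop, fun m hm hCm => (hC.le_of_ge hm hCm).antisymm hCm⟩

/-- In a K-dense net, every line has an element all of whose successors are below the line. -/
lemma KDense.exists_mem_forall_le (hK : N.KDense) {l : Set α} (hl : N.IsLine l) :
    ∃ z ∈ l, ∀ a, N.le z a → ∃ t ∈ l, N.le a t := by
  by_contra! hcon
  set S : Set α := {c | c ∈ N.B ∧ (∀ t ∈ l, ¬ N.le c t) ∧ ∃ e, N.F e c ∧ ∃ t ∈ l, N.le e t}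
  have hS : S.Pairwise N.co := by
    have key : ∀ c ∈ S, ∀ d ∈ S, c ≠ d → ¬ N.le c d := by
      rintro c ⟨-, hc, -⟩ d ⟨hdB, -, e, hed, t, ht, het⟩ hne hcd
      exact hc t ht (le_trans (le_of_F_of_mem_B hdB hed hcd hne) het)
    exact fun c hc d hd hne h => h.elim (key c hc d hd hne) (key d hd c hc hne.symm)
  obtain ⟨C, hSC, hC⟩ := exists_isCut_superset hS
  obtain ⟨z, hzC, hzl⟩ := hK C l hC hl
  obtain ⟨a, hza, ha⟩ := hcon z hzl
  have hex : ∃ c ∈ S, N.le z c := by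
    induction hza with
    | refl => exact (ha z hzl (le_refl z)).elim
    | @tail x y hzx hxy ih =>
      by_cases hx : ∀ t ∈ l, ¬ N.le x t
      · exact ih hx
      push Not at hx
      obtain ⟨t, ht, hxt⟩ := hx
      rcases N.bipartite x y hxy with ⟨hxB, -⟩ | ⟨-, hyB⟩
      · by_cases hne : x = t
        · subst hne
          refine (ha y (hl.mem_of_forall_li fun w hw => ?_) (le_refl y)).elim
          by_cases hxw : x = w
          · exact Or.inr (hxw ▸ le_of_F hxy)
          · rcases hl.li_of_mem ht hw with h | h
            · exact Or.inl (le_of_mem_B_of_F hxB hxy h hxw)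
            · exact Or.inr (le_trans h (le_of_F hxy))
        · exact (ha t ht (le_of_mem_B_of_F hxB hxy hxt hne)).elim
      · exact ⟨y, ⟨hyB, ha, x, hxy, t, ht, hxt⟩, le_trans hzx (le_of_F hxy)⟩
  obtain ⟨c, hcS, hzc⟩ := hex
  have hne : z ≠ c := fun h => hcS.2.1 z hzl (h ▸ le_refl z)
  exact hC.1 hzC (hSC hcS) hne (Or.inl hzc)

/-- The net with the flow relation reversed. -/
def op (N : CausalNet α) : CausalNet α where
  B := N.B
  E := N.E
  F x y := N.F y x
  countable_B := N.countable_B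
  countable_E := N.countable_E
  disjoint_BE := N.disjoint_BE
  cover := N.cover
  bipartite x y h := (N.bipartite y x h).symm.imp And.symm And.symm
  no_isolated x := (N.no_isolated x).symm
  pred_subsingleton := N.succ_subsingleton
  succ_subsingleton := N.pred_subsingleton
  acyclic x h := N.acyclic x (Relation.transGen_swap.1 h)

lemma op_le_iff {x y : α} : N.op.le x y ↔ N.le y x := Relation.reflTransGen_swap

lemma op_li : N.op.li = N.li := by
  funext x y
  simp only [li, op_le_iff, or_comm]

lemma op_co : N.op.co = N.co := by
  funext x y
  simp only [co, op_li]

lemma IsLine.op {l : Set α} (hl : N.IsLine l) : N.op.IsLine l := by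
  unfold IsLine
  rw [op_li]
  exact hl

lemma KDense.op (hK : N.KDense) : N.op.KDense := by
  unfold KDense IsCut IsLine
  rw [op_li, op_co]
  exact hK

lemma KDense.exists_mem_forall_ge (hK : N.KDense) {l : Set α} (hl : N.IsLine l) :
    ∃ z ∈ l, ∀ a, N.le a z → ∃ t ∈ l, N.le t a := by
  simpa only [op_le_iff] using hK.op.exists_mem_forall_le hl.op

/-- A finite nonempty set has a maximal element for the causal order. -/
lemma exists_le_maximal {T : Set α} (hT : T.Finite) (hne : T.Nonempty) :
    ∃ x ∈ T, ∀ y ∈ T, N.le x y → N.le y x := by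
  let _ : Preorder α :=
    { le := N.le, le_refl := le_refl, le_trans := fun _ _ _ => le_trans }
  obtain ⟨x, hx⟩ := hT.exists_maximal hne
  exact ⟨x, hx.prop, fun y hy hxy => hx.le_of_ge hy hxy⟩

lemma exists_le_minimal {T : Set α} (hT : T.Finite) (hne : T.Nonempty) :
    ∃ x ∈ T, ∀ y ∈ T, N.le y x → N.le x y := by
  simpa only [op_le_iff] using exists_le_maximal (N := N.op) hT hne

/-- If a line of a net with finite intervals is partitioned into elements satisfying `U` and
elements satisfying `D`, with some `U`-element below some `D`-element, then a single step of the
flow relation along the line leads from `U` to `D`. -/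
lemma IsLine.exists_F_of_le {l : Set α} (hl : N.IsLine l)
    (hfin : ∀ x y, (N.interval x y).Finite) {U D : α → Prop}
    (hUD : ∀ x ∈ l, U x ∨ D x) (hdisj : ∀ x, U x → ¬ D x)
    {u d : α} (hu : u ∈ l) (hd : d ∈ l) (hUu : U u) (hDd : D d) (hle : N.le u d) :
    ∃ x ∈ l, ∃ y ∈ l, N.F x y ∧ U x ∧ D y := by
  obtain ⟨x, ⟨⟨hux, hxd⟩, hxl, hUx⟩, hx⟩ := exists_le_maximal (N := N)
    ((hfin u d).subset (Set.inter_subset_left (t := {x | x ∈ l ∧ U x})))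
    ⟨u, ⟨le_refl u, hle⟩, hu, hUu⟩
  obtain ⟨y, ⟨⟨hxy, hyd⟩, hyl, hDy⟩, hy⟩ := exists_le_minimal (N := N)
    ((hfin x d).subset (Set.inter_subset_left (t := {x | x ∈ l ∧ D x})))
    ⟨d, ⟨hxd, le_refl d⟩, hd, hDd⟩
  rcases Relation.ReflTransGen.cases_head hxy with h | ⟨c, hxc, hcy⟩
  · exact (hdisj x hUx (h ▸ hDy)).elim
  have hcl : c ∈ l := by
    refine hl.mem_of_forall_li fun w hw => ?_
    rcases hl.li_of_mem hxl hw with hxw | hwx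
    · rcases hl.li_of_mem hyl hw with hyw | hwy
      · exact Or.inl (le_trans hcy hyw)
      · have hwd := le_trans hwy hyd
        rcases hUD w hw with h | h
        · exact Or.inr (le_trans (hx w ⟨⟨le_trans hux hxw, hwd⟩, hw, h⟩ hxw) (le_of_F hxc))
        · exact Or.inl (le_trans hcy (hy w ⟨⟨hxw, hwd⟩, hw, h⟩ hwy))
    · exact Or.inr (le_trans hwx (le_of_F hxc))
  refine ⟨x, hxl, c, hcl, hxc, hUx, (hUD c hcl).resolve_left fun h => ?_⟩
  exact not_le_of_F hxc (hx c ⟨⟨le_trans hux (le_of_F hxc), le_trans hcy hyd⟩, hcl, h⟩ (le_of_F hxc))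

end CausalNet


/-- In a locally finite, K-dense causal net, a line meets a closed
set `A` iff it does not meet its orthocomplement `A'`. -/
theorem line_meets_closed_iff_not_prime {α : Type*} (N : CausalNet α)
    (hLF : N.LocallyFinite) (hK : N.KDense)
    (A : Set α) (hA : N.Closed A) (l : Set α) (hl : N.IsLine l) :
    (l ∩ A).Nonempty ↔ l ∩ N.prime A = ∅ := by
  constructor
  · rintro ⟨x, hxl, hxA⟩
    exact Set.eq_empty_of_forall_notMem fun y ⟨hyl, hyA⟩ => hyA x hxA (hl.li_of_mem hyl hxl)
  · intro hempty
    by_contra hne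
    have hA₁ : ∀ x ∈ l, x ∉ A := fun x hx hxA => hne ⟨x, hx, hxA⟩
    have hA₂ : ∀ x ∈ l, x ∉ N.prime A := fun x hx hxA =>
      (Set.eq_empty_iff_forall_notMem.1 hempty) x ⟨hx, hxA⟩
    have hco : ∀ a ∈ A, ∀ b ∈ N.prime A, ∀ x, N.le a x → ¬ N.le x b :=
      fun a ha b hb x hax hxb => hb a ha (Or.inr (CausalNet.le_trans hax hxb))
    have hco' : ∀ a ∈ A, ∀ b ∈ N.prime A, ∀ x, N.le b x → ¬ N.le x a :=
      fun a ha b hb x hbx hxa => hb a ha (Or.inl (CausalNet.le_trans hbx hxa))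
    set U : α → Prop := fun x => ∃ a ∈ A, ∃ b ∈ N.prime A, N.le x a ∧ N.le x b
    set D : α → Prop := fun x => ∃ a ∈ A, ∃ b ∈ N.prime A, N.le a x ∧ N.le b x
    have hdisj : ∀ x, U x → ¬ D x := by
      rintro x ⟨a, ha, -, -, hxa, -⟩ ⟨-, -, b, hb, -, hbx⟩
      exact hco' a ha b hb x hbx hxa
    have hUD : ∀ x ∈ l, U x ∨ D x := by
      intro x hx
      have h₁ := hA₂ x hx
      have h₂ := hA₁ x hx
      rw [hA] at h₂
      simp only [CausalNet.prime, Set.mem_ofPred_eq, CausalNet.co, not_forall, not_not] at h₁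
      rw [CausalNet.prime] at h₂
      simp only [Set.mem_ofPred_eq, CausalNet.co, not_forall, not_not] at h₂
      obtain ⟨a, ha, hxa⟩ := h₁
      obtain ⟨b, hb, hxb⟩ := h₂
      rcases hxa with hxa | hax <;> rcases hxb with hxb | hbx
      · exact Or.inl ⟨a, ha, b, hb, hxa, hxb⟩
      · exact (hco' a ha b hb x hbx hxa).elim
      · exact (hco a ha b hb x hax hxb).elim
      · exact Or.inr ⟨a, ha, b, hb, hax, hbx⟩
    obtain ⟨d, hd, hDd⟩ : ∃ d ∈ l, D d := by
      obtain ⟨z, hz, hzl⟩ := hK.exists_mem_forall_le hl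
      rcases hUD z hz with ⟨a, ha, -, -, hza, -⟩ | h
      · obtain ⟨t, ht, hat⟩ := hzl a hza
        refine ⟨t, ht, (hUD t ht).resolve_left ?_⟩
        rintro ⟨-, -, b, hb, -, htb⟩
        exact hco a ha b hb t hat htb
      · exact ⟨z, hz, h⟩
    obtain ⟨u, hu, hUu⟩ : ∃ u ∈ l, U u := by
      obtain ⟨z, hz, hzl⟩ := hK.exists_mem_forall_ge hl
      rcases hUD z hz with h | ⟨a, ha, -, -, haz, -⟩
      · exact ⟨z, hz, h⟩
      · obtain ⟨t, ht, hta⟩ := hzl a haz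
        refine ⟨t, ht, (hUD t ht).resolve_right ?_⟩
        rintro ⟨-, -, b, hb, -, hbt⟩
        exact hco' a ha b hb t hbt hta
    have hle : N.le u d := by
      refine (hl.li_of_mem hu hd).resolve_right fun hdu => ?_
      obtain ⟨a, ha, -, -, hua, -⟩ := hUu
      obtain ⟨-, -, b, hb, -, hbd⟩ := hDd
      exact hco' a ha b hb d hbd (CausalNet.le_trans hdu hua)
    obtain ⟨x, hx, y, hy, hxy, hUx, hDy⟩ :=
      hl.exists_F_of_le hLF.1 hUD hdisj hu hd hUu hDd hle
    rcases N.bipartite x y hxy with ⟨hxB, -⟩ | ⟨-, hyB⟩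
    · obtain ⟨a, ha, b, hb, hxa, hxb⟩ := hUx
      exact hdisj y ⟨a, ha, b, hb,
        CausalNet.le_of_mem_B_of_F hxB hxy hxa fun h => hA₁ x hx (h ▸ ha),
        CausalNet.le_of_mem_B_of_F hxB hxy hxb fun h => hA₂ x hx (h ▸ hb)⟩ hDy
    · obtain ⟨a, ha, b, hb, hay, hby⟩ := hDy
      exact hdisj x hUx ⟨a, ha, b, hb,
        CausalNet.le_of_F_of_mem_B hyB hxy hay fun h => hA₁ y hy (h ▸ ha),
        CausalNet.le_of_F_of_mem_B hyB hxy hby fun h => hA₂ y hy (h ▸ hb)⟩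
end

section
/- Let N = (B,E,F) be a locally finite, K-dense causal net with X = B ∪ E. Let (A_i)_{i ∈ I} be a family of closed sets that are pairwise orthogonal (A_i ⊆ A_j' for all i ≠ j), and let λ be a line of N. If λ ∩ A_i = ∅ for every i ∈ I, then λ ∩ (⋃_{i ∈ I} A_i)'' = ∅. -/
namespace CausalNet

variable {α : Type*} (N : CausalNet α)

theorem co_symm {x y : α} (h : N.co x y) : N.co y x := fun h' => h h'.symm

theorem not_co_of_le {x y : α} (h : N.le x y) : ¬ N.co x y := fun h' => h' (Or.inl h)

theorem not_co_of_ge {x y : α} (h : N.le y x) : ¬ N.co x y := fun h' => h' (Or.inr h)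

theorem not_co_self (x : α) : ¬ N.co x x := N.not_co_of_le Relation.ReflTransGen.refl

theorem mem_B_or_mem_E (x : α) : x ∈ N.B ∨ x ∈ N.E := by
  have : x ∈ N.B ∪ N.E := N.cover ▸ Set.mem_univ x
  exact this

theorem mem_B_of_F_left {x y : α} (h : N.F x y) (hy : y ∈ N.E) : x ∈ N.B :=
  (N.bipartite x y h).elim And.left
    fun h' => (Set.disjoint_left.1 N.disjoint_BE h'.2 hy).elim

theorem mem_B_of_F_right {x y : α} (h : N.F x y) (hx : x ∈ N.E) : y ∈ N.B :=
  (N.bipartite x y h).elim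
    (fun h' => (Set.disjoint_left.1 N.disjoint_BE h'.1 hx).elim) And.right

/-- Everything strictly above a condition is above its only successor. -/
theorem le_of_F_of_le {b e x : α} (hb : b ∈ N.B) (hF : N.F b e) (h : N.le b x) (hne : b ≠ x) :
    N.le e x := by
  rcases Relation.ReflTransGen.cases_head h with rfl | ⟨c, hc, hcx⟩
  · exact (hne rfl).elim
  · rwa [N.succ_subsingleton b hb hF hc]

/-- Everything strictly below a condition is below its only predecessor. -/
theorem le_of_le_of_F {b e x : α} (hb : b ∈ N.B) (hF : N.F e b) (h : N.le x b) (hne : x ≠ b) :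
    N.le x e := by
  rcases Relation.ReflTransGen.cases_tail h with rfl | ⟨c, hxc, hc⟩
  · exact (hne rfl).elim
  · rwa [N.pred_subsingleton b hb hF hc]

variable {N} {A : Set α}

theorem Closed.mem_of_forall_co (hA : N.Closed A) {x : α} (h : ∀ w ∈ N.prime A, N.co x w) :
    x ∈ A := by
  rw [hA]
  exact h

theorem Closed.mem_of_le_of_le (hA : N.Closed A) {x y z : α} (hx : x ∈ A) (hy : y ∈ A)
    (hxz : N.le x z) (hzy : N.le z y) : z ∈ A := by
  refine hA.mem_of_forall_co fun w hw hzw => ?_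
  rcases hzw with hzw | hwz
  · exact N.not_co_of_ge (hxz.trans hzw) (hw x hx)
  · exact N.not_co_of_le (hwz.trans hzy) (hw y hy)

theorem Closed.pre_subset (hA : N.Closed A) {e : α} (he : e ∈ N.E) (heA : e ∈ A) :
    N.pre e ⊆ A := by
  intro b (hb : N.F b e)
  refine hA.mem_of_forall_co fun w hw hbw => ?_
  have hew := hw e heA
  rcases hbw with hbw | hwb
  · by_cases hne : b = w
    · subst hne
      exact N.not_co_of_le (Relation.ReflTransGen.single hb) hew
    · exact N.not_co_of_ge (N.le_of_F_of_le (N.mem_B_of_F_left hb he) hb hbw hne) hew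
  · exact N.not_co_of_le (hwb.tail hb) hew

theorem Closed.post_subset (hA : N.Closed A) {e : α} (he : e ∈ N.E) (heA : e ∈ A) :
    N.post e ⊆ A := by
  intro b (hb : N.F e b)
  refine hA.mem_of_forall_co fun w hw hbw => ?_
  have hew := hw e heA
  rcases hbw with hbw | hwb
  · exact N.not_co_of_ge (Relation.ReflTransGen.head hb hbw) hew
  · by_cases hne : w = b
    · subst hne
      exact N.not_co_of_ge (Relation.ReflTransGen.single hb) hew
    · exact N.not_co_of_le (N.le_of_le_of_F (N.mem_B_of_F_right hb he) hb hwb hne) hew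

variable (N) in
/-- Every set contains a maximal antichain. -/
theorem exists_maximal_antichain (S : Set α) :
    ∃ τ ⊆ S, τ.Pairwise N.co ∧ ∀ z ∈ S, ¬ ∀ t ∈ τ, N.co z t := by
  obtain ⟨τ, hτ⟩ := zorn_subset {τ | τ ⊆ S ∧ τ.Pairwise N.co} fun c hc hchain =>
    ⟨⋃₀ c, ⟨Set.sUnion_subset fun t ht => (hc ht).1,
      (Set.pairwise_sUnion hchain.directedOn).2 fun t ht => (hc ht).2⟩,
      fun _ => Set.subset_sUnion_of_mem⟩
  refine ⟨τ, hτ.prop.1, hτ.prop.2, fun z hz hco => N.not_co_self z (hco z ?_)⟩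
  refine hτ.le_of_ge ⟨Set.insert_subset hz hτ.prop.1, hτ.prop.2.insert fun t ht _ =>
    ⟨hco t ht, N.co_symm (hco t ht)⟩⟩ (Set.subset_insert z τ) (Set.mem_insert z τ)

theorem Closed.not_le_of_forall_co (hA : N.Closed A) {τ : Set α} (hτ : τ ⊆ A)
    (hmax : ∀ z ∈ A, ¬ ∀ t ∈ τ, N.co z t) {z a : α} (ha : a ∈ A) (hz : ∀ t ∈ τ, N.co z t) :
    ¬ N.le z a := by
  intro hza
  induction hza using Relation.ReflTransGen.head_induction_on with
  | refl => exact hmax a ha hz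
  | @head z v hzv hva ih =>
    refine ih fun t ht hvt => ?_
    rcases hvt with hvt | htv
    · exact N.not_co_of_le (Relation.ReflTransGen.head hzv hvt) (hz t ht)
    · have hvA := hA.mem_of_le_of_le (hτ ht) ha htv hva
      rcases N.mem_B_or_mem_E v with hv | hv
      · by_cases hne : t = v
        · subst hne
          exact N.not_co_of_le (Relation.ReflTransGen.single hzv) (hz t ht)
        · exact N.not_co_of_ge (N.le_of_le_of_F hv hzv htv hne) (hz t ht)
      · exact hmax z (hA.pre_subset hv hvA hzv) hz

theorem Closed.not_ge_of_forall_co (hA : N.Closed A) {τ : Set α} (hτ : τ ⊆ A)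
    (hmax : ∀ z ∈ A, ¬ ∀ t ∈ τ, N.co z t) {z a : α} (ha : a ∈ A) (hz : ∀ t ∈ τ, N.co z t) :
    ¬ N.le a z := by
  intro haz
  induction haz with
  | refl => exact hmax a ha hz
  | @tail v z hav hvz ih =>
    refine ih fun t ht hvt => ?_
    rcases hvt with hvt | htv
    · have hvA := hA.mem_of_le_of_le ha (hτ ht) hav hvt
      rcases N.mem_B_or_mem_E v with hv | hv
      · by_cases hne : v = t
        · subst hne
          exact N.not_co_of_ge (Relation.ReflTransGen.single hvz) (hz v ht)
        · exact N.not_co_of_le (N.le_of_F_of_le hv hvz hvt hne) (hz t ht)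
      · exact hmax z (hA.post_subset hv hvA hvz) hz
    · exact N.not_co_of_ge (htv.tail hvz) (hz t ht)

/-- An element concurrent with a maximal antichain of a closed set is concurrent with the whole
set. -/
theorem Closed.mem_prime_of_forall_co (hA : N.Closed A) {τ : Set α} (hτ : τ ⊆ A)
    (hmax : ∀ z ∈ A, ¬ ∀ t ∈ τ, N.co z t) {z : α} (hz : ∀ t ∈ τ, N.co z t) :
    z ∈ N.prime A := fun _ ha h =>
  h.elim (hA.not_le_of_forall_co hτ hmax ha hz) (hA.not_ge_of_forall_co hτ hmax ha hz)

end CausalNet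

/-- In a locally finite, K-dense causal net, if a line misses every
member of a pairwise orthogonal family of closed sets, then it misses their
join `(⋃ A_i)''`. -/
theorem line_misses_join {α : Type*} (N : CausalNet α)
    (hLF : N.LocallyFinite) (hK : N.KDense)
    {ι : Type*} (A : ι → Set α) (hA : ∀ i, N.Closed (A i))
    (horth : Pairwise fun i j => A i ⊆ N.prime (A j))
    (l : Set α) (hl : N.IsLine l) (h : ∀ i, l ∩ A i = ∅) :
    l ∩ N.prime (N.prime (⋃ i, A i)) = ∅ := by
  choose τ hτA hτ hτmax using fun i => N.exists_maximal_antichain (A i)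
  obtain ⟨σ, hσS, hσ, hσmax⟩ := N.exists_maximal_antichain (N.prime (⋃ i, A i))
  have hσA : ∀ s ∈ σ, ∀ i, ∀ a ∈ A i, N.co s a := fun s hs i a ha =>
    hσS hs a (Set.mem_iUnion.2 ⟨i, ha⟩)
  have hcut : N.IsCut ((⋃ i, τ i) ∪ σ) := by
    refine ⟨?_, fun m hm hsub => Set.Subset.antisymm (fun z hz => ?_) hsub⟩
    · rintro x (hx | hx) y (hy | hy) hne
      · obtain ⟨i, hx⟩ := Set.mem_iUnion.1 hx
        obtain ⟨j, hy⟩ := Set.mem_iUnion.1 hy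
        by_cases hij : i = j
        · subst hij
          exact hτ i hx hy hne
        · exact horth hij (hτA i hx) y (hτA j hy)
      · obtain ⟨i, hx⟩ := Set.mem_iUnion.1 hx
        exact N.co_symm (hσA y hy i x (hτA i hx))
      · obtain ⟨j, hy⟩ := Set.mem_iUnion.1 hy
        exact hσA x hx j y (hτA j hy)
      · exact hσ hx hy hne
    · by_contra hzc
      have hco : ∀ t ∈ (⋃ i, τ i) ∪ σ, N.co z t := fun t ht =>
        hm hz (hsub ht) fun hzt => hzc (hzt ▸ ht)
      refine hσmax z (fun a ha => ?_) fun s hs => hco s (Or.inr hs)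
      obtain ⟨i, hai⟩ := Set.mem_iUnion.1 ha
      exact (hA i).mem_prime_of_forall_co (hτA i) (hτmax i)
        (fun t ht => hco t (Or.inl (Set.mem_iUnion.2 ⟨i, ht⟩))) a hai
  obtain ⟨y, hy | hy, hyl⟩ := hK _ l hcut hl
  · obtain ⟨i, hy⟩ := Set.mem_iUnion.1 hy
    exact ((h i).subset ⟨hyl, hτA i hy⟩).elim
  · refine Set.eq_empty_of_forall_notMem fun x ⟨hxl, hx⟩ => ?_
    have hxy := hx y (hσS hy)
    by_cases hne : x = y
    · exact N.not_co_self x (hne ▸ hxy)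
    · exact hxy (hl.1 hxl hyl hne)
end

section
/- Let N = (B,E,F) be a locally finite causal net with X = B ∪ E. Then the complete ortholattice of closed sets of N is orthomodular: for all closed sets A, C ⊆ X with A ⊆ C, it holds that C = (A ∪ (C ∩ A'))''. -/
namespace CausalNet

open Relation

/-- If `x` lies in the polar of `K`, `y` in the polar of `A`, where `A` is contained in the polar
of `K`, and `y` is reachable from `x`, then the two polars meet. Here every step of the relation
is required to be either the only one out of its source or the only one into its target. -/
theorem exists_mem_polars_of_reflTransGen {α : Type*} {R : α → α → Prop}
    (hR : ∀ x y, R x y → (∀ z, R x z → z = y) ∨ (∀ z, R z y → z = x))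
    {co : α → α → Prop}
    (hco : ∀ x y, co x y ↔ ¬ (ReflTransGen R x y ∨ ReflTransGen R y x))
    {K A : Set α} (hAK : ∀ a ∈ A, ∀ k ∈ K, co a k) {x y : α}
    (hxy : ReflTransGen R x y) (hx : ∀ k ∈ K, co x k) (hy : ∀ a ∈ A, co y a) :
    ∃ z, (∀ k ∈ K, co z k) ∧ ∀ a ∈ A, co z a := by
  simp only [hco, not_or] at *
  induction hxy using ReflTransGen.head_induction_on with
  | refl => exact ⟨y, hx, hy⟩
  | @head x w hxw hwy ih =>
    by_cases hw : ∀ k ∈ K, ¬ ReflTransGen R w k ∧ ¬ ReflTransGen R k w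
    · exact ih hw
    · push Not at hw
      obtain ⟨k, hk, hkw⟩ := hw
      replace hkw : ReflTransGen R k w :=
        hkw fun h => (hx k hk).1 (h.head hxw)
      refine ⟨x, hx, fun a ha => ⟨fun hxa => ?_, fun hax => ?_⟩⟩
      · rcases hR x w hxw with h | h
        · rcases hxa.cases_head with rfl | ⟨v, hxv, hva⟩
          · exact (hy x ha).2 (hwy.head hxw)
          · exact (hAK a ha k hk).2 (hkw.trans (h v hxv ▸ hva))
        · rcases hkw.cases_tail with rfl | ⟨v, hkv, hvw⟩
          · exact (hx w hk).1 (.single hxw)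
          · exact (hx k hk).2 (h v hvw ▸ hkv)
      · exact (hy a ha).2 (hax.trans (hwy.head hxw))

theorem unique_succ_or_unique_pred {α : Type*} (N : CausalNet α) (x y : α) (h : N.F x y) :
    (∀ z, N.F x z → z = y) ∨ (∀ z, N.F z y → z = x) := by
  rcases N.bipartite x y h with ⟨hx, -⟩ | ⟨-, hy⟩
  · exact .inl fun z hz => N.succ_subsingleton x hx hz h
  · exact .inr fun z hz => N.pred_subsingleton y hy hz h

theorem co_comm {α : Type*} (N : CausalNet α) {x y : α} : N.co x y ↔ N.co y x :=
  not_congr or_comm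

theorem subset_prime_comm {α : Type*} (N : CausalNet α) {S T : Set α} :
    S ⊆ N.prime T ↔ T ⊆ N.prime S :=
  ⟨fun h _ ht _ hs => N.co_comm.1 (h hs _ ht), fun h _ hs _ ht => N.co_comm.1 (h ht _ hs)⟩

theorem prime_anti {α : Type*} (N : CausalNet α) {S T : Set α} (h : S ⊆ T) :
    N.prime T ⊆ N.prime S :=
  fun _ hx y hy => hx y (h hy)

theorem prime_inter_prime_nonempty {α : Type*} (N : CausalNet α) {K A : Set α}
    (hAK : A ⊆ N.prime K) {x y : α} (hx : x ∈ N.prime K) (hy : y ∈ N.prime A)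
    (hxy : N.li x y) : (N.prime K ∩ N.prime A).Nonempty := by
  rcases hxy with h | h
  · exact exists_mem_polars_of_reflTransGen N.unique_succ_or_unique_pred
      (fun _ _ => Iff.rfl) hAK h hx hy
  · refine exists_mem_polars_of_reflTransGen (R := Function.swap N.F) (co := N.co)
      (fun u v huv => (N.unique_succ_or_unique_pred v u huv).symm) (fun u v => ?_) hAK
      (reflTransGen_swap.2 h) hx hy
    exact not_congr (or_comm.trans (or_congr reflTransGen_swap.symm reflTransGen_swap.symm))

end CausalNet

/-- In a locally finite causal net, the complete ortholattice of
closed sets is orthomodular: for closed `A ⊆ C`, `C = (A ∪ (C ∩ A'))''`. -/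
theorem closed_sets_orthomodular {α : Type*} (N : CausalNet α)
    (hLF : N.LocallyFinite)
    (A C : Set α) (hA : N.Closed A) (hC : N.Closed C) (hAC : A ⊆ C) :
    C = N.prime (N.prime (A ∪ (C ∩ N.prime A))) := by
  set K := N.prime C
  set S := A ∪ (C ∩ N.prime A)
  have hC' : C = N.prime K := hC
  have hSC : S ⊆ N.prime K := hC' ▸ Set.union_subset hAC Set.inter_subset_left
  apply Set.Subset.antisymm
  · intro x hx y hy hxy
    obtain ⟨z, hzK, hzS⟩ := N.prime_inter_prime_nonempty hSC (hC' ▸ hx) hy hxy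
    have hz : z ∈ S :=
      .inr ⟨hC'.symm ▸ hzK, N.prime_anti Set.subset_union_left hzS⟩
    exact hzS z hz (.inl .refl)
  · rw [hC']
    exact N.prime_anti (N.subset_prime_comm.1 hSC)
end
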